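/- Fix n ≥ 1 and γ ∈ ℕ^n, and for α ∈ ℕ^n and b ∈ ℕ define Γ(α, b) := α! · ∏_{j=1}^{b} max_{1≤i≤n} (α_i + j(γ_i + 1)). Then for all α, δ ∈ ℕ^n with δ ≤ α + γ (componentwise) and all b ∈ ℕ: (α!/δ!) · max_{1≤i≤n} Γ(δ + e_i, b) ≤ Γ(α, b + 1), where e_i denotes the multi-index with 1 in the i-th place and 0 elsewhere. -/

import Mathlib

/-- The quantity `Γ(α, b) = α! · ∏_{j=1}^{b} max_{1≤i≤n} (α_i + j(γ_i + 1))`. -/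
def Gamma' {n : ℕ} (γ : Fin n → ℕ) (α : Fin n → ℕ) (b : ℕ) : ℕ :=
  (∏ i, Nat.factorial (α i)) *
    ∏ j ∈ Finset.range b, (Finset.univ.sup fun i : Fin n => α i + (j + 1) * (γ i + 1))

theorem prod_factorial_add_single {n : ℕ} (δ : Fin n → ℕ) (i : Fin n) :
    ∏ k, Nat.factorial ((δ + Pi.single i 1 : Fin n → ℕ) k) = (δ i + 1) * ∏ k, Nat.factorial (δ k) := by
  rw [← Finset.mul_prod_erase _ _ (Finset.mem_univ i),
    ← Finset.mul_prod_erase _ (fun k => Nat.factorial (δ k)) (Finset.mem_univ i), ← mul_assoc]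
  congr 1
  · simp [Nat.factorial_succ]
  · refine Finset.prod_congr rfl fun k hk => ?_
    simp [Finset.ne_of_mem_erase hk]

theorem prod_factorial_mul_gamma_add_single_le {n : ℕ} (γ α δ : Fin n → ℕ)
    (hδ : ∀ i, δ i ≤ α i + γ i) (b : ℕ) (i : Fin n) :
    (∏ k, Nat.factorial (α k)) * Gamma' γ (δ + Pi.single i 1) b ≤
      Gamma' γ α (b + 1) * ∏ k, Nat.factorial (δ k) := by
  have hfirst : δ i + 1 ≤ Finset.univ.sup fun k : Fin n => α k + (0 + 1) * (γ k + 1) :=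
    le_trans (by have := hδ i; lia)
      (Finset.le_sup (f := fun k : Fin n => α k + (0 + 1) * (γ k + 1)) (Finset.mem_univ i))
  have hrest : ∏ j ∈ Finset.range b,
        (Finset.univ.sup fun k : Fin n =>
          (δ + Pi.single i 1 : Fin n → ℕ) k + (j + 1) * (γ k + 1)) ≤
      ∏ j ∈ Finset.range b,
        (Finset.univ.sup fun k : Fin n => α k + (j + 1 + 1) * (γ k + 1)) := by
    refine Finset.prod_le_prod' fun j _ => Finset.sup_mono_fun fun k _ => ?_
    have hsingle : (Pi.single i 1 : Fin n → ℕ) k ≤ 1 := by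
      rw [Pi.single_apply]
      split_ifs <;> simp
    have := hδ k
    rw [Pi.add_apply, add_mul (j + 1) 1]
    lia
  rw [Gamma', Gamma', prod_factorial_add_single, Finset.prod_range_succ']
  calc
    _ = (∏ k, Nat.factorial (α k)) * (∏ k, Nat.factorial (δ k)) *
        ((∏ j ∈ Finset.range b, (Finset.univ.sup fun k : Fin n =>
          (δ + Pi.single i 1 : Fin n → ℕ) k + (j + 1) * (γ k + 1))) * (δ i + 1)) := by ring
    _ ≤ _ := Nat.mul_le_mul_left _ (Nat.mul_le_mul hrest hfirst)
    _ = _ := by ring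

/-- **Combinatorial inequality for `Γ` used in the inductive regularity estimate:**
for `δ ≤ α + γ`, `(α!/δ!) · max_i Γ(δ + e_i, b) ≤ Γ(α, b + 1)`. -/
theorem gamma_inequality {n : ℕ} (hn : 0 < n) (γ α δ : Fin n → ℕ)
    (hδ : ∀ i, δ i ≤ α i + γ i) (b : ℕ) :
    ((∏ i, Nat.factorial (α i) : ℕ) : ℝ) / ((∏ i, Nat.factorial (δ i) : ℕ) : ℝ) *
        ((Finset.univ.sup fun i : Fin n => Gamma' γ (δ + Pi.single i 1) b : ℕ) : ℝ) ≤
      ((Gamma' γ α (b + 1) : ℕ) : ℝ) := by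
  have hpos : 0 < ∏ i, Nat.factorial (δ i) :=
    Finset.prod_pos fun i _ => Nat.factorial_pos (δ i)
  obtain ⟨i, -, hi⟩ := Finset.exists_mem_eq_sup Finset.univ ⟨⟨0, hn⟩, Finset.mem_univ _⟩
    fun i : Fin n => Gamma' γ (δ + Pi.single i 1) b
  rw [hi, div_mul_eq_mul_div, div_le_iff₀ (by exact_mod_cast hpos)]
  exact_mod_cast prod_factorial_mul_gamma_add_single_le γ α δ hδ b i
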